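/- arXiv:2207.01131 — 3 statements merged into one kernel-verified Lean document; each statement's English description precedes it below -/
import Mathlib

section
/- For every α ∈ (0, 1/2) there exists a unique μ > 0 such that α = 1/μ − e^{−μ}/(1 − e^{−μ}). -/
theorem exp_neg_div_one_sub_exp_neg (μ : ℝ) :
    Real.exp (-μ) / (1 - Real.exp (-μ)) = 1 / (Real.exp μ - 1) := by
  rw [← mul_div_mul_left _ _ (Real.exp_ne_zero μ), mul_sub, ← Real.exp_add]
  simp

theorem sq_mul_exp_lt_sq_exp_sub_one {μ : ℝ} (hμ : 0 < μ) :
    μ ^ 2 * Real.exp μ < (Real.exp μ - 1) ^ 2 := by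
  have h : μ / 2 < Real.sinh (μ / 2) := Real.self_lt_sinh_iff.2 (by positivity)
  have hexp : Real.exp μ = Real.exp (μ / 2) ^ 2 := by
    rw [← Real.exp_nat_mul]; congr 1; push_cast; ring
  have hmul : Real.exp (μ / 2) * Real.exp (-(μ / 2)) = 1 := by
    rw [← Real.exp_add]; simp
  have hlt : μ * Real.exp (μ / 2) < Real.exp μ - 1 := by
    rw [Real.sinh_eq] at h
    nlinarith [Real.exp_pos (μ / 2)]
  calc μ ^ 2 * Real.exp μ = (μ * Real.exp (μ / 2)) ^ 2 := by rw [hexp]; ring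
    _ < (Real.exp μ - 1) ^ 2 := by gcongr

theorem hasDerivAt_one_div_sub_one_div_exp_sub_one {μ : ℝ} (hμ : 0 < μ) :
    HasDerivAt (fun x : ℝ => 1 / x - 1 / (Real.exp x - 1))
      (-1 / μ ^ 2 + Real.exp μ / (Real.exp μ - 1) ^ 2) μ := by
  have h : Real.exp μ - 1 ≠ 0 := (sub_pos.2 (Real.one_lt_exp_iff.2 hμ)).ne'
  simp only [one_div]
  exact (((hasDerivAt_id' μ).fun_inv hμ.ne').sub
    (((Real.hasDerivAt_exp μ).sub_const 1).fun_inv h)).congr_deriv (by ring)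

theorem continuousOn_one_div_sub_one_div_exp_sub_one :
    ContinuousOn (fun x : ℝ => 1 / x - 1 / (Real.exp x - 1)) (Set.Ioi 0) := fun _ hx =>
  (hasDerivAt_one_div_sub_one_div_exp_sub_one hx).continuousAt.continuousWithinAt

theorem strictAntiOn_one_div_sub_one_div_exp_sub_one :
    StrictAntiOn (fun x : ℝ => 1 / x - 1 / (Real.exp x - 1)) (Set.Ioi 0) := by
  refine strictAntiOn_of_deriv_neg (convex_Ioi 0)
    continuousOn_one_div_sub_one_div_exp_sub_one fun x hx => ?_
  rw [interior_Ioi, Set.mem_Ioi] at hx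
  rw [(hasDerivAt_one_div_sub_one_div_exp_sub_one hx).deriv, neg_div, neg_add_lt_iff_lt_add,
    add_zero, div_lt_div_iff₀ (pow_pos (sub_pos.2 (Real.one_lt_exp_iff.2 hx)) 2) (by positivity)]
  linarith [sq_mul_exp_lt_sq_exp_sub_one hx]

theorem one_div_add_two_le_one_div_sub_one_div_exp_sub_one {μ : ℝ} (hμ : 0 < μ) :
    1 / (μ + 2) ≤ 1 / μ - 1 / (Real.exp μ - 1) := by
  have h : 1 / (Real.exp μ - 1) ≤ 1 / (μ + μ ^ 2 / 2) :=
    one_div_le_one_div_of_le (by positivity) (by linarith [Real.quadratic_le_exp_of_nonneg hμ.le])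
  have heq : 1 / (μ + μ ^ 2 / 2) = 1 / μ - 1 / (μ + 2) := by
    field_simp
    ring
  linarith

/-- For every `α ∈ (0, 1/2)` there is a unique `μ > 0` with
`α = 1/μ − e^{−μ}/(1 − e^{−μ})`. -/
theorem existsUnique_avgToPeakRatio_eq (α : ℝ) (hα : α ∈ Set.Ioo (0 : ℝ) (1 / 2)) :
    ∃! μ : ℝ, 0 < μ ∧ α = 1 / μ - Real.exp (-μ) / (1 - Real.exp (-μ)) := by
  obtain ⟨h0, h2⟩ := hα
  simp only [exp_neg_div_one_sub_exp_neg]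
  have ha : 0 < 1 / α - 2 := by
    rw [sub_pos, lt_div_iff₀ h0]
    linarith
  have hlower := one_div_add_two_le_one_div_sub_one_div_exp_sub_one ha
  rw [sub_add_cancel, one_div_one_div] at hlower
  have hupper : 1 / (1 / α) - 1 / (Real.exp (1 / α) - 1) ≤ α := by
    rw [one_div_one_div]
    have : 0 < Real.exp (1 / α) - 1 := sub_pos.2 (Real.one_lt_exp_iff.2 (by positivity))
    exact sub_le_self _ (by positivity)
  obtain ⟨μ, hμ, hμα⟩ := intermediate_value_Icc' (by linarith : 1 / α - 2 ≤ 1 / α)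
    (continuousOn_one_div_sub_one_div_exp_sub_one.mono fun x hx => ha.trans_le hx.1)
    ⟨hupper, hlower⟩
  have hμ0 : 0 < μ := ha.trans_le hμ.1
  exact ⟨μ, ⟨hμ0, hμα.symm⟩, fun ν hν =>
    strictAntiOn_one_div_sub_one_div_exp_sub_one.injOn hν.1 hμ0 (hν.2.symm.trans hμα.symm)⟩
end

section
/- For every μ > 0, exp(2 μ f(μ)) · ((1 − e^{−μ})/μ)² ≤ 1, where f(μ) = 1/μ − e^{−μ}/(1 − e^{−μ}). Equivalently, with α = f(μ), the coefficient ρ(α) = (e^{2αμ−1}/(2π)) · ((1 − e^{−μ})/μ)² satisfies ρ(α) ≤ 1/(2πe). -/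
open Real

lemma monotone_sub_two_mul_exp_add_self :
    Monotone fun y : ℝ => (y - 2) * Real.exp y + y := by
  have hd (y : ℝ) : HasDerivAt (fun y : ℝ => (y - 2) * Real.exp y + y)
      (1 * Real.exp y + (y - 2) * Real.exp y + 1) y :=
    (((hasDerivAt_id y).sub_const 2).mul (Real.hasDerivAt_exp y)).add (hasDerivAt_id y)
  refine monotone_of_deriv_nonneg (fun y => (hd y).differentiableAt) fun y => ?_
  rw [(hd y).deriv]
  have h := mul_le_mul_of_nonneg_right (Real.add_one_le_exp (-y)) (Real.exp_pos y).le
  rw [← Real.exp_add, neg_add_cancel, Real.exp_zero] at h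
  linarith

/-- The differential entropy of the exponential density truncated to the unit interval is
nonpositive. -/
lemma one_sub_le_log_div_one_sub_exp_neg {μ : ℝ} (hμ : 0 < μ) :
    1 - μ * Real.exp (-μ) / (1 - Real.exp (-μ)) ≤ Real.log (μ / (1 - Real.exp (-μ))) := by
  have hx : 0 < 1 - Real.exp (-μ) := by
    have : Real.exp (-μ) < 1 := Real.exp_lt_one_iff.mpr (neg_lt_zero.mpr hμ)
    linarith
  set c := Real.log (μ / (1 - Real.exp (-μ))) with hc
  set t := μ * Real.exp (-μ) / (1 - Real.exp (-μ)) with ht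
  have hexp : Real.exp c = μ / (1 - Real.exp (-μ)) := Real.exp_log (div_pos hμ hx)
  have hexp_sub : Real.exp (c - μ) = t := by
    rw [sub_eq_add_neg, Real.exp_add, hexp, ht]
    ring
  have hexp_add : Real.exp c = t + μ := by
    rw [hexp, ht]
    field_simp
    ring
  have h := monotone_sub_two_mul_exp_add_self (sub_le_self c hμ.le)
  simp only [hexp_sub, hexp_add] at h
  have hprod : 0 ≤ μ * (c + t - 1) := by linarith
  linarith [nonneg_of_mul_nonneg_right hprod hμ]

/-- For every `μ > 0`, `exp(2μ f(μ)) · ((1 − e^{−μ})/μ)² ≤ 1` where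
`f(μ) = 1/μ − e^{−μ}/(1 − e^{−μ})`; equivalently, with `α = f(μ)`,
`ρ(α) = (e^{2αμ−1}/(2π)) · ((1 − e^{−μ})/μ)² ≤ 1/(2πe)`. -/
theorem truncExp_entropyCoeff_le (μ : ℝ) (hμ : 0 < μ) :
    Real.exp (2 * μ * (1 / μ - Real.exp (-μ) / (1 - Real.exp (-μ)))) *
        ((1 - Real.exp (-μ)) / μ) ^ 2 ≤ 1 ∧
      Real.exp (2 * (1 / μ - Real.exp (-μ) / (1 - Real.exp (-μ))) * μ - 1) / (2 * π) *
          ((1 - Real.exp (-μ)) / μ) ^ 2 ≤ 1 / (2 * π * Real.exp 1) := by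
  have hx : 0 < 1 - Real.exp (-μ) := by
    have : Real.exp (-μ) < 1 := Real.exp_lt_one_iff.mpr (neg_lt_zero.mpr hμ)
    linarith
  have hle : Real.exp (2 * μ * (1 / μ - Real.exp (-μ) / (1 - Real.exp (-μ)))) *
      ((1 - Real.exp (-μ)) / μ) ^ 2 ≤ 1 := by
    have hsq : ((1 - Real.exp (-μ)) / μ) ^ 2 =
        Real.exp (-(2 * Real.log (μ / (1 - Real.exp (-μ))))) := by
      rw [Real.exp_neg (2 * _), two_mul, Real.exp_add, Real.exp_log (div_pos hμ hx), ← sq, ← inv_pow,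
        inv_div]
    have hf : 2 * μ * (1 / μ - Real.exp (-μ) / (1 - Real.exp (-μ))) =
        2 * (1 - μ * Real.exp (-μ) / (1 - Real.exp (-μ))) := by
      field_simp
    rw [hsq, hf, ← Real.exp_add, Real.exp_le_one_iff]
    linarith [one_sub_le_log_div_one_sub_exp_neg hμ]
  refine ⟨hle, ?_⟩
  have hπ : 0 < 2 * π * Real.exp 1 := by positivity
  rw [mul_right_comm, Real.exp_sub]
  calc _ = Real.exp (2 * μ * (1 / μ - Real.exp (-μ) / (1 - Real.exp (-μ)))) *
        ((1 - Real.exp (-μ)) / μ) ^ 2 / (2 * π * Real.exp 1) := by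
        rw [div_div, div_mul_eq_mul_div, mul_comm (Real.exp 1)]
    _ ≤ _ := div_le_div_of_nonneg_right hle hπ.le
end

section
/- For every real δ with 1/2 ≤ δ < 1 and every constant c > 0, lim_{t→∞} [log(1 + t^{2(1−δ)}) + min{ log(1 + t^{4δ−2}/(c²(1 + t^{δ−1})²)), (1/2)·log(1 + (1 + t^{2(δ−1)})·t^{2δ}/(c²(1 + t^{δ−1})²)) }]/(2 log t) = min{δ, 1 − δ/2} (the limit is independent of the logarithm base). -/
open Filter

/-- Multiplying a real power by a function with a positive limit does not change its growth
exponent. -/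
theorem tendsto_log_rpow_mul_div_log {f : ℝ → ℝ} {L : ℝ} (a : ℝ) (hL : 0 < L)
    (hf : Tendsto f atTop (nhds L)) :
    Tendsto (fun t : ℝ => Real.log (t ^ a * f t) / Real.log t) atTop (nhds a) := by
  have hlim : Tendsto (fun t : ℝ => a + Real.log (f t) / Real.log t) atTop (nhds (a + 0)) :=
    tendsto_const_nhds.add ((hf.log hL.ne').div_atTop Real.tendsto_log_atTop)
  rw [add_zero] at hlim
  refine hlim.congr' ?_
  filter_upwards [hf.eventually_const_lt hL, eventually_gt_atTop 1] with t hft ht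
  have ht0 : 0 < t := zero_lt_one.trans ht
  have hlog : Real.log t ≠ 0 := (Real.log_pos ht).ne'
  rw [Real.log_mul (Real.rpow_pos_of_pos ht0 a).ne' hft.ne', Real.log_rpow ht0]
  field_simp

/-- A nonnegative growth exponent is unchanged by adding `1`. -/
theorem tendsto_log_one_add_rpow_mul_div_log {f : ℝ → ℝ} {a L : ℝ} (ha : 0 ≤ a) (hL : 0 < L)
    (hf : Tendsto f atTop (nhds L)) :
    Tendsto (fun t : ℝ => Real.log (1 + t ^ a * f t) / Real.log t) atTop (nhds a) := by
  obtain ⟨M, hM, hlim⟩ : ∃ M : ℝ, 0 < M ∧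
      Tendsto (fun t : ℝ => t ^ (-a) + f t) atTop (nhds M) := by
    rcases ha.eq_or_lt with rfl | ha
    · exact ⟨1 + L, by positivity, by simpa using hf.const_add 1⟩
    · exact ⟨L, hL, by simpa using (tendsto_rpow_neg_atTop ha).add hf⟩
  refine (tendsto_log_rpow_mul_div_log a hM hlim).congr' ?_
  filter_upwards [eventually_gt_atTop 0] with t ht
  rw [mul_add, ← Real.rpow_add ht, add_neg_cancel, Real.rpow_zero]

/-- For `1/2 ≤ δ < 1` and `c > 0`, the Han–Kobayashi achievable GDoF:
`lim_{t→∞} [log(1 + t^{2(1−δ)}) + min{log(1 + t^{4δ−2}/(c²(1 + t^{δ−1})²)),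
(1/2)·log(1 + (1 + t^{2(δ−1)}) t^{2δ}/(c²(1 + t^{δ−1})²))}]/(2 log t)
  = min{δ, 1 − δ/2}`. -/
theorem tendsto_gdof_hk_total (δ c : ℝ) (hδ0 : 1 / 2 ≤ δ) (hδ1 : δ < 1) (hc : 0 < c) :
    Tendsto (fun t : ℝ =>
        (Real.log (1 + t ^ (2 * (1 - δ))) +
          min (Real.log (1 + t ^ (4 * δ - 2) / (c ^ 2 * (1 + t ^ (δ - 1)) ^ 2)))
            ((1 / 2) * Real.log (1 + (1 + t ^ (2 * (δ - 1))) * t ^ (2 * δ) /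
              (c ^ 2 * (1 + t ^ (δ - 1)) ^ 2)))) / (2 * Real.log t))
      atTop (nhds (min δ (1 - δ / 2))) := by
  have hg : Tendsto (fun t : ℝ => t ^ (δ - 1)) atTop (nhds 0) := by
    simpa using tendsto_rpow_neg_atTop (sub_pos.2 hδ1)
  have hg2 : Tendsto (fun t : ℝ => t ^ (2 * (δ - 1))) atTop (nhds 0) := by
    convert tendsto_rpow_neg_atTop (show 0 < 2 * (1 - δ) by linarith) using 3
    ring
  have hden : Tendsto (fun t : ℝ => c ^ 2 * (1 + t ^ (δ - 1)) ^ 2) atTop (nhds (c ^ 2)) := by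
    simpa using ((hg.const_add 1).pow 2).const_mul (c ^ 2)
  have hc2 : 0 < c ^ 2 := by positivity
  have h₁ := tendsto_log_one_add_rpow_mul_div_log (show 0 ≤ 2 * (1 - δ) by linarith) one_pos
    tendsto_const_nhds
  have h₂ := tendsto_log_one_add_rpow_mul_div_log (show 0 ≤ 4 * δ - 2 by linarith)
    (inv_pos.2 hc2) (hden.inv₀ hc2.ne')
  have h₃ := tendsto_log_one_add_rpow_mul_div_log (show 0 ≤ 2 * δ by linarith)
    (show 0 < (1 + 0) / c ^ 2 by positivity) ((hg2.const_add 1).div hden hc2.ne')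
  have h := (h₁.div_const 2).add ((h₂.div_const 2).min (h₃.div_const 4))
  have hval : 2 * (1 - δ) / 2 + min ((4 * δ - 2) / 2) (2 * δ / 4) = min δ (1 - δ / 2) := by
    rw [← min_add_add_left]
    congr 1 <;> ring
  rw [hval] at h
  refine h.congr' ?_
  filter_upwards [eventually_gt_atTop 1] with t ht
  have hlog : 0 < Real.log t := Real.log_pos ht
  rw [add_div, ← min_div_div_right (by positivity)]
  congr 1
  · rw [mul_one, div_div, mul_comm (Real.log t)]
  · congr 1
    · rw [← div_eq_mul_inv, div_div, mul_comm (Real.log t)]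
    · simp only [Pi.div_apply]
      rw [mul_div_assoc', mul_comm (t ^ (2 * δ))]
      ring
end
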